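/- Let G be a finite group, let {n(H, φ)} be a family of integers indexed by pairs (H, φ) with H a cyclic subgroup of G or H = G and φ a character of H, satisfying additivity n(H, φ_1 + φ_2) = n(H, φ_1) + n(H, φ_2) and induction invariance n(G, Ind_H^G φ) = n(H, φ) for every cyclic subgroup H and character φ of H. Let ρ be a character of G such that n(H, ρ|_H ⊗ φ) ≥ 0 for every cyclic subgroup H of G and every irreducible character φ of H. Then Σ_{χ ∈ Irr(G)} n(G, ρ ⊗ χ)² ≤ n(G, ρ ⊗ Reg_G)². -/

import Mathlib

open scoped Classical

/-- `f : G → ℂ` is the character of some finite-dimensional complex representation of `G`. -/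
def IsChar (G : Type) [Group G] (f : G → ℂ) : Prop :=
  ∃ V : FDRep ℂ G, f = V.character

/-- `f : G → ℂ` is the character of some irreducible (simple) finite-dimensional complex
representation of `G`. -/
def IsIrrChar (G : Type) [Group G] (f : G → ℂ) : Prop :=
  ∃ V : FDRep ℂ G, CategoryTheory.Simple V ∧ f = V.character

/-- Induction of a class function from a subgroup `H` of `G` to `G`:
`(Ind_H^G f)(x) = |H|⁻¹ ∑_{g ∈ G} f̂(g⁻¹ x g)`, where `f̂` agrees with `f` on `H`
and vanishes off `H`. -/
noncomputable def indChar {G : Type} [Group G] [Fintype G] (H : Subgroup G) (f : H → ℂ) :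
    G → ℂ := fun x =>
  (Nat.card H : ℂ)⁻¹ * ∑ g : G, if h : g⁻¹ * x * g ∈ H then f ⟨g⁻¹ * x * g, h⟩ else 0

/-- The usual inner product of class functions on a finite group:
`(f₁, f₂) = |G|⁻¹ ∑_{g ∈ G} f₁(g) conj (f₂ g)`. -/
noncomputable def cfInner (G : Type) [Group G] [Fintype G] (f₁ f₂ : G → ℂ) : ℂ :=
  (Fintype.card G : ℂ)⁻¹ * ∑ g : G, f₁ g * (starRingEnd ℂ) (f₂ g)

/-- The regular character of a finite group `G` (the character of the regular
representation, i.e. `Reg_G = ∑_{χ ∈ Irr G} χ(1)·χ`): it takes the value `|G|` at the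
identity and `0` elsewhere. -/
noncomputable def regChar (G : Type) [Group G] [Fintype G] : G → ℂ :=
  fun g => if g = 1 then (Fintype.card G : ℂ) else 0

/-- The level `l(χ)` of a character of a solvable group: the least `i ≥ 0` such that the
restriction of `χ` to the `i`-th derived subgroup `G^i` equals `χ(1)` times the trivial
character of `G^i`. -/
noncomputable def charLevel (G : Type) [Group G] (χ : G → ℂ) : ℕ :=
  sInf {i : ℕ | ∀ g ∈ derivedSeries G i, χ g = χ 1}

lemma Representation.isChar {G : Type} [Group G] {V : Type} [AddCommGroup V] [Module ℂ V]
    [FiniteDimensional ℂ V] (σ : Representation ℂ G V) : IsChar G σ.character :=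
  ⟨FDRep.of σ, rfl⟩

namespace IsChar

variable {G : Type} [Group G] {f₁ f₂ : G → ℂ}

lemma zero : IsChar G 0 := by
  have h : (Representation.trivial ℂ G PUnit).character = 0 := by
    ext g
    have : Representation.trivial ℂ G PUnit g = 0 := Subsingleton.elim _ _
    simp [Representation.character, this]
  exact h ▸ (Representation.trivial ℂ G PUnit).isChar

lemma add (h₁ : IsChar G f₁) (h₂ : IsChar G f₂) : IsChar G (f₁ + f₂) := by
  obtain ⟨V, rfl⟩ := h₁
  obtain ⟨W, rfl⟩ := h₂
  have h : (Representation.prod V.ρ W.ρ).character = V.character + W.character := by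
    ext g
    exact LinearMap.trace_prodMap' (V.ρ g) (W.ρ g)
  exact h ▸ (Representation.prod V.ρ W.ρ).isChar

lemma mul (h₁ : IsChar G f₁) (h₂ : IsChar G f₂) : IsChar G (f₁ * f₂) := by
  obtain ⟨V, rfl⟩ := h₁
  obtain ⟨W, rfl⟩ := h₂
  exact FDRep.char_tensor V W ▸ ⟨_, rfl⟩

lemma restrict (h : IsChar G f₁) (H : Subgroup G) : IsChar H (fun x => f₁ x) := by
  obtain ⟨V, rfl⟩ := h
  exact Representation.isChar (V.ρ.comp H.subtype : Representation ℂ H V)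

lemma conj (h : IsChar G f₁) (x g : G) : f₁ (x * g * x⁻¹) = f₁ g := by
  obtain ⟨V, rfl⟩ := h
  exact V.char_conj g x

end IsChar

lemma IsIrrChar.isChar {G : Type} [Group G] {f : G → ℂ} (h : IsIrrChar G f) : IsChar G f :=
  let ⟨V, _, hV⟩ := h
  ⟨V, hV⟩

lemma isIrrChar_of_sum_eq_card {G : Type} [Group G] [Fintype G] {f : G → ℂ} (h : IsChar G f)
    (hf : ∑ g, f g * f g⁻¹ = Nat.card G) : IsIrrChar G f := by
  obtain ⟨V, rfl⟩ := h
  exact ⟨V, (FDRep.simple_iff_char_is_norm_one V).mpr hf, rfl⟩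

/-- A linear character, regarded as a one-dimensional representation. -/
noncomputable def MonoidHom.toRepresentation {G : Type} [Group G] (μ : G →* ℂ) :
    Representation ℂ G ℂ :=
  (Algebra.lmul ℂ ℂ : ℂ →* Module.End ℂ ℂ).comp μ

lemma MonoidHom.isIrrChar {G : Type} [Group G] [Fintype G] (μ : G →* ℂ) : IsIrrChar G μ := by
  have h : μ.toRepresentation.character = μ := by
    ext g
    simp [Representation.character, MonoidHom.toRepresentation, LinearMap.trace_eq_matrix_trace
      ℂ (Module.Basis.singleton Unit ℂ), Matrix.trace, LinearMap.toMatrix_apply]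
  refine isIrrChar_of_sum_eq_card (h ▸ μ.toRepresentation.isChar) ?_
  simp_rw [← map_mul, mul_inv_cancel, map_one]
  simp

lemma LinearMap.IsProj.trace_restrict {V : Type*} [AddCommGroup V] [Module ℂ V]
    [FiniteDimensional ℂ V] {p : Submodule ℂ V} {π : V →ₗ[ℂ] V} (hπ : LinearMap.IsProj p π)
    {f : V →ₗ[ℂ] V} (hf : ∀ v ∈ p, f v ∈ p) :
    LinearMap.trace ℂ p (f.restrict hf) = LinearMap.trace ℂ V (f ∘ₗ π) := by
  have h₁ : f ∘ₗ π = p.subtype ∘ₗ (f.restrict hf ∘ₗ π.codRestrict p hπ.map_mem) := by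
    ext v
    simp
  have h₂ : f.restrict hf = (f.restrict hf ∘ₗ π.codRestrict p hπ.map_mem) ∘ₗ p.subtype := by
    ext v
    simp [hπ.map_id v v.2]
  rw [h₁, LinearMap.trace_comp_comm', ← h₂]

namespace Representation

variable {G V : Type} [Group G] [AddCommGroup V] [Module ℂ V] [FiniteDimensional ℂ V]

lemma character_eq_add_of_isCompl (σ : Representation ℂ G V) {W W' : Subrepresentation σ}
    (h : IsCompl W.toSubmodule W'.toSubmodule) :
    σ.character = W.toRepresentation.character + W'.toRepresentation.character := by
  ext g
  have h₁ := LinearMap.IsProj.trace_restrict (p := W.toSubmodule)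
    (π := W.toSubmodule.projection W'.toSubmodule h)
    ⟨Submodule.projection_apply_mem h,
      fun x hx => Submodule.projection_apply_of_mem_left h hx⟩ (W.apply_mem_toSubmodule g)
  have h₂ := LinearMap.IsProj.trace_restrict (p := W'.toSubmodule)
    (π := W'.toSubmodule.projection W.toSubmodule h.symm)
    ⟨Submodule.projection_apply_mem h.symm,
      fun x hx => Submodule.projection_apply_of_mem_left h.symm hx⟩ (W'.apply_mem_toSubmodule g)
  calc LinearMap.trace ℂ V (σ g)
      = LinearMap.trace ℂ V (σ g ∘ₗ W.toSubmodule.projection W'.toSubmodule h) +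
        LinearMap.trace ℂ V (σ g ∘ₗ W'.toSubmodule.projection W.toSubmodule h.symm) := by
        rw [← map_add, ← LinearMap.comp_add, Submodule.projection_add_projection_eq_id,
          LinearMap.comp_id]
    _ = _ := by rw [← h₁, ← h₂]; rfl

lemma IsIrreducible.isIrrChar [Fintype G] (σ : Representation ℂ G V) [IsIrreducible σ] :
    IsIrrChar G σ.character := by
  refine isIrrChar_of_sum_eq_card σ.isChar ?_
  have : Invertible (Nat.card G : ℂ) := invertibleOfNonzero (NeZero.ne _)
  have h := char_orthonormal σ σ
  rw [if_pos ⟨Equiv.refl σ⟩, inv_mul_eq_one₀ (NeZero.ne _)] at h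
  exact h.symm

lemma character_mem_closure_isIrrChar [Fintype G] (σ : Representation ℂ G V) :
    σ.character ∈ AddSubmonoid.closure {χ : G → ℂ | IsIrrChar G χ} := by
  induction hn : Module.finrank ℂ V using Nat.strong_induction_on generalizing V with
  | _ n ih =>
  subst hn
  rcases subsingleton_or_nontrivial V with hV | hV
  · have : σ.character = 0 := by
      ext g
      have : σ g = 0 := Subsingleton.elim _ _
      simp [Representation.character, this]
    exact this ▸ zero_mem _
  by_cases hσ : IsIrreducible σ
  · exact AddSubmonoid.subset_closure (IsIrreducible.isIrrChar σ)
  have : Nontrivial (Subrepresentation σ) :=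
    ⟨⊥, ⊤, fun h => bot_ne_top (congrArg Subrepresentation.toSubmodule h)⟩
  obtain ⟨W, hW, hW'⟩ : ∃ W : Subrepresentation σ, W ≠ ⊥ ∧ W ≠ ⊤ := by
    by_contra! h
    exact hσ ⟨fun W => or_iff_not_imp_left.mpr (h W)⟩
  obtain ⟨W', hc⟩ := exists_isCompl W
  have hc' : IsCompl W.toSubmodule W'.toSubmodule := by
    rw [isCompl_iff, disjoint_iff, codisjoint_iff]
    exact ⟨congrArg Subrepresentation.toSubmodule hc.inf_eq_bot,
      congrArg Subrepresentation.toSubmodule hc.sup_eq_top⟩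
  have hlt : Module.finrank ℂ W.toSubmodule < Module.finrank ℂ V :=
    Submodule.finrank_lt fun h => hW' (Subrepresentation.toSubmodule_injective h)
  have hpos : Module.finrank ℂ W.toSubmodule ≠ 0 := fun h =>
    hW (Subrepresentation.toSubmodule_injective (Submodule.finrank_eq_zero.mp h))
  have hadd := Submodule.finrank_add_eq_of_isCompl hc'
  rw [σ.character_eq_add_of_isCompl hc']
  exact add_mem (ih _ hlt _ rfl) (ih _ (by omega) _ rfl)

end Representation

lemma IsChar.mem_closure_isIrrChar {G : Type} [Group G] [Fintype G] {f : G → ℂ}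
    (h : IsChar G f) : f ∈ AddSubmonoid.closure {χ : G → ℂ | IsIrrChar G χ} := by
  obtain ⟨V, rfl⟩ := h
  exact Representation.character_mem_closure_isIrrChar V.ρ

section Induction

variable {G : Type} [Group G] [Fintype G] (H : Subgroup G) (μ : H →* ℂ)

/-- The action of `G` on complex functions on `G` by right translation. -/
def rightTranslation (G : Type) [Group G] : Representation ℂ G (G → ℂ) where
  toFun g := LinearMap.funLeft ℂ ℂ (· * g)
  map_one' := by ext; simp [LinearMap.funLeft]
  map_mul' a b := by ext; simp [LinearMap.funLeft, mul_assoc]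

omit [Fintype G] in
@[simp]
lemma rightTranslation_apply (g x : G) (f : G → ℂ) : rightTranslation G g f x = f (x * g) := rfl

/-- The projection of the functions on `G` onto those satisfying `f (h * x) = μ h * f x` for all
`h ∈ H`. -/
noncomputable def equivariantProj : (G → ℂ) →ₗ[ℂ] (G → ℂ) where
  toFun f x := (Nat.card H : ℂ)⁻¹ * ∑ h : H, μ h⁻¹ * f (h * x)
  map_add' f₁ f₂ := by ext x; simp [mul_add, Finset.sum_add_distrib]
  map_smul' c f := by
    ext x
    simp only [Pi.smul_apply, smul_eq_mul, Finset.mul_sum, RingHom.id_apply]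
    exact Finset.sum_congr rfl fun _ _ => by ring

lemma equivariantProj_apply (f : G → ℂ) (x : G) :
    equivariantProj H μ f x = (Nat.card H : ℂ)⁻¹ * ∑ h : H, μ h⁻¹ * f (h * x) := rfl

lemma equivariantProj_apply_mul (f : G → ℂ) (h : H) (x : G) :
    equivariantProj H μ f (h * x) = μ h * equivariantProj H μ f x := by
  simp only [equivariantProj_apply]
  rw [mul_left_comm]
  congr 1
  rw [Finset.mul_sum, ← Equiv.sum_comp (Equiv.mulRight h) (fun k => μ h * _)]
  refine Finset.sum_congr rfl fun k _ => ?_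
  simp only [Equiv.coe_mulRight, Subgroup.coe_mul, ← mul_assoc, ← map_mul, mul_inv_rev,
    mul_inv_cancel, one_mul]

lemma isIdempotentElem_equivariantProj : IsIdempotentElem (equivariantProj H μ) := by
  refine LinearMap.ext fun f => funext fun x => ?_
  rw [Module.End.mul_apply, equivariantProj_apply]
  simp_rw [equivariantProj_apply_mul, ← mul_assoc, ← map_mul, inv_mul_cancel, map_one]
  simp

/-- The representation induced from the linear character `μ` of `H`. -/
noncomputable def inducedSubrepresentation : Subrepresentation (rightTranslation G) where
  toSubmodule := LinearMap.range (equivariantProj H μ)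
  apply_mem_toSubmodule := by
    rintro g _ ⟨f, rfl⟩
    exact ⟨rightTranslation G g f, by ext x; simp [equivariantProj_apply, mul_assoc]⟩

lemma character_inducedSubrepresentation :
    (inducedSubrepresentation H μ).toRepresentation.character = indChar H μ := by
  ext g
  have h := LinearMap.IsProj.trace_restrict
    ((LinearMap.isProj_range_iff_isIdempotentElem _).mpr (isIdempotentElem_equivariantProj H μ))
    ((inducedSubrepresentation H μ).apply_mem_toSubmodule g)
  refine h.trans ?_
  rw [LinearMap.trace_eq_matrix_trace ℂ (Pi.basisFun ℂ G), Matrix.trace, indChar, Finset.mul_sum,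
    ← Equiv.sum_comp (Equiv.inv G)]
  refine Finset.sum_congr rfl fun x _ => ?_
  simp only [Matrix.diag_apply, LinearMap.toMatrix_apply, LinearMap.comp_apply,
    Pi.basisFun_repr, rightTranslation_apply, equivariantProj_apply, Pi.basisFun_apply,
    Equiv.inv_apply]
  congr 1
  have hk (k : H) (hk : (k : G) * (x⁻¹ * g) = x⁻¹) : (k⁻¹ : G) = x⁻¹ * g * x := by
    rw [inv_eq_iff_mul_eq_one, ← mul_assoc, hk, inv_mul_cancel]
  split_ifs with hx
  · rw [Finset.sum_eq_single ⟨x⁻¹ * g * x, hx⟩⁻¹]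
    · simp [mul_assoc]
    · intro k _ hne
      rw [Pi.single_eq_of_ne, mul_zero]
      exact fun h' => hne (inv_eq_iff_eq_inv.mp (Subtype.ext (hk k h')))
    · simp
  · refine Finset.sum_eq_zero fun k _ => ?_
    rw [Pi.single_eq_of_ne, mul_zero]
    exact fun h' => hx (hk k h' ▸ inv_mem k.2)

lemma isChar_indChar : IsChar G (indChar H μ) :=
  character_inducedSubrepresentation H μ ▸ Representation.isChar _

end Induction

lemma regChar_eq_indChar_bot (G : Type) [Group G] [Fintype G] :
    regChar G = indChar (⊥ : Subgroup G) (1 : (⊥ : Subgroup G) →* ℂ) := by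
  ext x
  have h (g : G) : g⁻¹ * x * g = 1 ↔ x = 1 := by
    rw [← conj_eq_one_iff (a := g⁻¹) (b := x), inv_inv]
  simp [regChar, indChar, h]

/-- The bilinear form `(f₁, f₂) ↦ |G|⁻¹ ∑ g, f₁ g * f₂ g⁻¹` on functions on a finite group. -/
noncomputable def charPairing (G : Type) [Group G] [Fintype G] :
    (G → ℂ) →ₗ[ℂ] (G → ℂ) →ₗ[ℂ] ℂ :=
  LinearMap.mk₂ ℂ (fun f₁ f₂ => (Nat.card G : ℂ)⁻¹ * ∑ g, f₁ g * f₂ g⁻¹)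
    (fun _ _ _ => by simp [add_mul, mul_add, Finset.sum_add_distrib])
    (fun _ _ _ => by simp [Finset.mul_sum, mul_assoc, mul_left_comm])
    (fun _ _ _ => by simp [mul_add, Finset.sum_add_distrib])
    (fun _ _ _ => by simp [Finset.mul_sum, mul_left_comm])

section Pairing

variable {G : Type} [Group G] [Fintype G]

lemma charPairing_apply (f₁ f₂ : G → ℂ) :
    charPairing G f₁ f₂ = (Nat.card G : ℂ)⁻¹ * ∑ g, f₁ g * f₂ g⁻¹ := rfl

lemma charPairing_irrChar {χ ψ : G → ℂ} (hχ : IsIrrChar G χ) (hψ : IsIrrChar G ψ) :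
    charPairing G χ ψ = if χ = ψ then 1 else 0 := by
  obtain ⟨V, hV, rfl⟩ := hχ
  obtain ⟨W, hW, rfl⟩ := hψ
  have : Invertible (Nat.card G : ℂ) := invertibleOfNonzero (NeZero.ne _)
  split_ifs with h
  · rw [h, charPairing_apply, FDRep.char_orthonormal, if_pos ⟨CategoryTheory.Iso.refl W⟩]
  · rw [charPairing_apply, FDRep.char_orthonormal, if_neg]
    exact fun ⟨i⟩ => h (FDRep.char_iso i)

lemma finite_setOf_isIrrChar (G : Type) [Group G] [Fintype G] :
    {χ : G → ℂ | IsIrrChar G χ}.Finite := by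
  have h : LinearIndependent ℂ (Subtype.val : {χ : G → ℂ | IsIrrChar G χ} → G → ℂ) := by
    rw [linearIndependent_iff']
    intro s c hc χ hχ
    have := congrArg (fun f => charPairing G f χ) hc
    simpa [charPairing_irrChar (Subtype.prop _) χ.2, ← Subtype.ext_iff, hχ] using this
  exact h.setFinite

/-- Frobenius reciprocity for a linear character of a subgroup. -/
lemma charPairing_indChar {f : G → ℂ} (hf : ∀ x g, f (x * g * x⁻¹) = f g) (H : Subgroup G)
    (φ : H → ℂ) :
    charPairing G f (indChar H φ) = (Nat.card H : ℂ)⁻¹ * ∑ h : H, f h * φ h⁻¹ := by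
  set F : G → ℂ := fun k => if h : k ∈ H then φ ⟨k, h⟩ else 0 with hF
  have key (x : G) : ∑ g, f g * F (x⁻¹ * g⁻¹ * x) = ∑ h : H, f h * φ h⁻¹ := by
    have hx (g : G) : f (x * g * x⁻¹) * F (x⁻¹ * (x * g * x⁻¹)⁻¹ * x) = f g * F g⁻¹ := by
      rw [hf]
      congr 2
      group
    rw [← Equiv.sum_comp (MulAut.conj x).toEquiv]
    refine (Finset.sum_congr rfl fun g _ => hx g).trans ?_
    refine (Finset.sum_of_injOn Subtype.val Subtype.val_injective.injOn (by simp) ?_ ?_).symm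
    · intro g _ hg
      have : g ∉ H := by simpa using hg
      simp [hF, this]
    · intro h _
      simp only [hF, inv_mem_iff, SetLike.coe_mem, dite_true]
      rfl
  calc charPairing G f (indChar H φ)
      = (Nat.card G : ℂ)⁻¹ * ∑ g, (Nat.card H : ℂ)⁻¹ * ∑ x, f g * F (x⁻¹ * g⁻¹ * x) := by
        simp only [charPairing_apply, indChar, mul_left_comm (f _), hF]
        simp only [Finset.mul_sum]
    _ = _ := by
        rw [← Finset.mul_sum, Finset.sum_comm, Finset.sum_congr rfl fun x _ => key x,
          Finset.sum_const, Finset.card_univ, nsmul_eq_mul, Nat.card_eq_fintype_card (α := G),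
          mul_left_comm, inv_mul_cancel_left₀ (by simp)]

end Pairing

/-- A function on a finite cyclic group with nonnegative Fourier coefficients is bounded by its
value at the identity. -/
lemma norm_le_of_fourierCoeff_nonneg {A : Type} [Group A] [Fintype A] [IsCyclic A] {f : A → ℂ}
    (hf : ∀ μ : A →* ℂ, ∃ r : ℝ, 0 ≤ r ∧ (Nat.card A : ℂ)⁻¹ * ∑ a, f a * μ a⁻¹ = r) (a : A) :
    ‖f a‖ ≤ ‖f 1‖ := by
  let _ : CommGroup A := IsCyclic.commGroup
  let toHom (ψ : AddChar (Additive A) ℂ) : A →* ℂ :=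
    { toFun a := ψ (Additive.ofMul a)
      map_one' := ψ.map_zero_eq_one
      map_mul' a b := ψ.map_add_eq_mul _ _ }
  choose r hr hrf using fun ψ => hf (toHom ψ)
  have expand (a : A) : f a = ∑ ψ, (r ψ : ℂ) * ψ (Additive.ofMul a) := by
    have hψ (ψ : AddChar (Additive A) ℂ) : (r ψ : ℂ) * ψ (Additive.ofMul a) =
        (Nat.card A : ℂ)⁻¹ * ∑ b, f b * ψ (Additive.ofMul (b⁻¹ * a)) := by
      rw [← hrf, mul_assoc, Finset.sum_mul]
      congr 1
      refine Finset.sum_congr rfl fun b _ => ?_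
      rw [ofMul_mul, ψ.map_add_eq_mul, ← mul_assoc]
      rfl
    simp_rw [hψ, ← Finset.mul_sum]
    rw [Finset.sum_comm]
    simp_rw [← Finset.mul_sum, AddChar.sum_apply_eq_ite, ofMul_eq_zero, inv_mul_eq_one]
    simp [mul_comm]
  have h1 : f 1 = ((∑ ψ, r ψ : ℝ) : ℂ) := by simp [expand]
  rw [h1, Complex.norm_of_nonneg (Finset.sum_nonneg fun ψ _ => hr ψ), expand]
  refine (norm_sum_le _ _).trans (Finset.sum_le_sum fun ψ _ => ?_)
  simp [abs_of_nonneg (hr ψ)]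

lemma indChar_mul {G : Type} [Group G] [Fintype G] {f : G → ℂ}
    (hf : ∀ x g, f (x * g * x⁻¹) = f g) (H : Subgroup G) (φ : H → ℂ) :
    f * indChar H φ = indChar H (fun h => f h * φ h) := by
  ext x
  simp only [Pi.mul_apply, indChar]
  rw [mul_left_comm, Finset.mul_sum]
  congr 1
  refine Finset.sum_congr rfl fun g _ => ?_
  have := hf g⁻¹ x
  rw [inv_inv] at this
  split_ifs <;> simp [this]

/-- **twisted weak arithmetic Foote–Murty inequality.** Let `(nG, n)` be a
family of integers on a finite group `G` (attached to the whole group and to each cyclic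
subgroup) that is additive on characters and invariant under induction from cyclic subgroups.
If `ρ` is a character of `G` such that `n(H, ρ|_H ⊗ φ) ≥ 0` for every cyclic subgroup `H` and
every irreducible character `φ` of `H`, then
`∑_{χ ∈ Irr G} n(G, ρ ⊗ χ)² ≤ n(G, ρ ⊗ Reg_G)²`. -/
theorem twisted_weak_arithmetic_foote_murty_inequality
    (G : Type) [Group G] [Fintype G]
    (nG : (G → ℂ) → ℤ) (n : (H : Subgroup G) → (H → ℂ) → ℤ)
    (haddG : ∀ φ₁ φ₂ : G → ℂ, IsChar G φ₁ → IsChar G φ₂ →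
      nG (φ₁ + φ₂) = nG φ₁ + nG φ₂)
    (haddH : ∀ (H : Subgroup G), IsCyclic H → ∀ φ₁ φ₂ : H → ℂ,
      IsChar H φ₁ → IsChar H φ₂ → n H (φ₁ + φ₂) = n H φ₁ + n H φ₂)
    (hind : ∀ (H : Subgroup G), IsCyclic H → ∀ φ : H → ℂ, IsChar H φ →
      nG (indChar H φ) = n H φ)
    (ρ : G → ℂ) (hρ : IsChar G ρ)
    (htwist : ∀ (H : Subgroup G), IsCyclic H → ∀ φ : H → ℂ, IsIrrChar H φ →
      0 ≤ n H (fun h => ρ (h : G) * φ h)) :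
    ∑ᶠ χ ∈ {χ : G → ℂ | IsIrrChar G χ}, (nG (ρ * χ)) ^ 2 ≤ (nG (ρ * regChar G)) ^ 2 := by
  set S := {χ : G → ℂ | IsIrrChar G χ}
  have hfin : S.Finite := finite_setOf_isIrrChar G
  have hpos (H : Subgroup G) (hH : IsCyclic H) (μ : H →* ℂ) : 0 ≤ nG (ρ * indChar H μ) := by
    rw [indChar_mul hρ.conj, hind H hH (fun h => ρ h * μ h) ((hρ.restrict H).mul μ.isIrrChar.isChar)]
    exact htwist H hH μ μ.isIrrChar
  set Θ : G → ℂ := ∑ χ ∈ hfin.toFinset, (nG (ρ * χ) : ℂ) • χ with hΘ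
  have hΘconj (x g : G) : Θ (x * g * x⁻¹) = Θ g := by
    simp only [hΘ, Finset.sum_apply, Pi.smul_apply]
    refine Finset.sum_congr rfl fun χ hχ => ?_
    rw [IsChar.conj (IsIrrChar.isChar (hfin.mem_toFinset.mp hχ))]
  have hirr (χ : G → ℂ) (hχ : χ ∈ S) : charPairing G Θ χ = nG (ρ * χ) := by
    rw [hΘ, map_sum, LinearMap.sum_apply, Finset.sum_eq_single χ]
    · simp [charPairing_irrChar hχ hχ]
    · intro ψ hψ hne
      simp [charPairing_irrChar (hfin.mem_toFinset.mp hψ) hχ, hne]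
    · exact fun h => absurd (hfin.mem_toFinset.mpr hχ) h
  have hchar (f : G → ℂ) (hf : IsChar G f) : charPairing G Θ f = nG (ρ * f) := by
    suffices IsChar G f ∧ charPairing G Θ f = nG (ρ * f) from this.2
    have hmem := hf.mem_closure_isIrrChar
    clear hf
    induction hmem using AddSubmonoid.closure_induction with
    | mem χ hχ => exact ⟨IsIrrChar.isChar hχ, hirr χ hχ⟩
    | zero =>
      have h := haddG 0 0 IsChar.zero IsChar.zero
      rw [add_zero, left_eq_add] at h
      simp [IsChar.zero, h]
    | add f₁ f₂ _ _ h₁ h₂ =>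
      refine ⟨IsChar.add h₁.1 h₂.1, ?_⟩
      rw [map_add, h₁.2, h₂.2, mul_add, haddG _ _ (hρ.mul h₁.1) (hρ.mul h₂.1), Int.cast_add]
  have hΘ1 : Θ 1 = nG (ρ * regChar G) := by
    rw [← hchar _ (regChar_eq_indChar_bot G ▸ isChar_indChar _ _), charPairing_apply]
    simp [regChar, mul_comm (Θ 1)]
  have hbound (g : G) : ‖Θ g‖ ≤ ‖Θ 1‖ := by
    refine norm_le_of_fourierCoeff_nonneg (A := Subgroup.zpowers g) (f := fun h => Θ h)
      (fun μ => ⟨nG (ρ * indChar (Subgroup.zpowers g) μ), ?_, ?_⟩) ⟨g, Subgroup.mem_zpowers g⟩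
    · exact_mod_cast hpos _ inferInstance μ
    · rw [← charPairing_indChar hΘconj, hchar _ (isChar_indChar _ μ)]
      simp
  have hnorm : ‖charPairing G Θ Θ‖ ≤ ‖Θ 1‖ ^ 2 := by
    rw [charPairing_apply, norm_mul, norm_inv, Complex.norm_natCast,
      inv_mul_le_iff₀ (by exact_mod_cast Nat.card_pos)]
    refine (norm_sum_le _ _).trans ?_
    calc ∑ g : G, ‖Θ g * Θ g⁻¹‖ ≤ ∑ g : G, ‖Θ 1‖ ^ 2 := Finset.sum_le_sum fun g _ => by
          rw [norm_mul, sq]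
          exact mul_le_mul (hbound _) (hbound _) (norm_nonneg _) (norm_nonneg _)
      _ = Nat.card G * ‖Θ 1‖ ^ 2 := by simp
  have hself : charPairing G Θ Θ = ((∑ χ ∈ hfin.toFinset, nG (ρ * χ) ^ 2 : ℤ) : ℂ) := by
    conv_lhs => rw [hΘ, map_sum (charPairing G _), ← hΘ]
    push_cast
    refine Finset.sum_congr rfl fun χ hχ => ?_
    rw [map_smul, hirr χ (hfin.mem_toFinset.mp hχ), smul_eq_mul, sq]
  rw [finsum_mem_eq_finite_toFinset_sum _ hfin]
  rw [hself, hΘ1, Complex.norm_intCast, Complex.norm_intCast, sq_abs] at hnorm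
  exact_mod_cast (le_abs_self _).trans hnorm
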